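/- Let β ≠ 0 and a > 0, and let λ_{1,γ,a} denote the principal eigenvalue of the Rayleigh–Kuo operator L_{[γ,a]} = −d²/dy² + (U_{γ,a}'' − β)/U_{γ,a} on (−1,1) with Dirichlet boundary conditions, where U_{γ,a} is the modified shear profile. Then limsup_{γ→0⁺} λ_{1,γ,a} ≤ 3 + (3/2) b₀ a, where b₀ = 2∫₀² (1/(x+5)³ − 1/(5−x)³) erf(x) Ĩ(x) dx < 0. In particular, for fixed a > −2/b₀, λ_{1,γ,a} < 0 for all sufficiently small γ > 0. -/

import Mathlib

open MeasureTheory Real Set Filter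

/-- The Gauss error function `erf(x) = (2/√π) ∫₀ˣ e^{-t²} dt`. -/
noncomputable def erf (x : ℝ) : ℝ := 2 / Real.sqrt π * ∫ t in (0:ℝ)..x, Real.exp (-t ^ 2)

/-- The modified shear profile
`U_{γ,a}(y) = y + (β/2) y² Ĩ(y/γ) + a γ² erf((y-5γ)/γ) Ĩ((y-5γ)/γ)`. -/
noncomputable def Uprof (Icut : ℝ → ℝ) (β γ a : ℝ) (y : ℝ) : ℝ :=
  y + β / 2 * y ^ 2 * Icut (y / γ) + a * γ ^ 2 * erf ((y - 5 * γ) / γ) * Icut ((y - 5 * γ) / γ)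

/-- Values of the quadratic form `∫_{-1}^1 (|φ'|² + q |φ|²)` over `L²`-normalized
`φ ∈ H₀¹(-1,1)`. -/
noncomputable def rqSet (q : ℝ → ℝ) : Set ℝ :=
  { r | ∃ φ dφ : ℝ → ℝ,
      (∀ y, HasDerivAt φ (dφ y) y) ∧ φ (-1) = 0 ∧ φ 1 = 0 ∧
      IntervalIntegrable (fun y => dφ y ^ 2) volume (-1) 1 ∧
      IntervalIntegrable (fun y => q y * φ y ^ 2) volume (-1) 1 ∧
      (∫ y in (-1:ℝ)..1, φ y ^ 2) = 1 ∧
      r = ∫ y in (-1:ℝ)..1, (dφ y ^ 2 + q y * φ y ^ 2) }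

/-- The principal eigenvalue `λ_{1,γ,a}` of the Rayleigh–Kuo operator
`L_{[γ,a]} = -d²/dy² + (U_{γ,a}'' - β)/U_{γ,a}` on `(-1,1)` with Dirichlet
boundary conditions, defined variationally. -/
noncomputable def lam1 (Icut : ℝ → ℝ) (β γ a : ℝ) : ℝ :=
  sInf (rqSet (fun y => (iteratedDeriv 2 (Uprof Icut β γ a) y - β) / Uprof Icut β γ a y))

/-- The constant `b₀ = 2 ∫₀² (1/(x+5)³ - 1/(5-x)³) erf(x) Ĩ(x) dx`. -/
noncomputable def b0 (Icut : ℝ → ℝ) : ℝ :=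
  2 * ∫ x in (0:ℝ)..2, (1 / (x + 5) ^ 3 - 1 / (-x + 5) ^ 3) * erf x * Icut x

lemma hasDerivAt_erf (x : ℝ) : HasDerivAt erf (2 / √π * exp (-x ^ 2)) x := by
  have hc : Continuous fun t : ℝ => exp (-t ^ 2) := by fun_prop
  exact (intervalIntegral.integral_hasDerivAt_right (hc.intervalIntegrable 0 x)
    (hc.stronglyMeasurableAtFilter _ _) hc.continuousAt).const_mul (2 / √π)

lemma contDiff_erf : ContDiff ℝ (⊤ : ℕ∞) erf := by
  rw [contDiff_infty_iff_deriv]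
  refine ⟨fun x => (hasDerivAt_erf x).differentiableAt, ?_⟩
  rw [show deriv erf = fun x => 2 / √π * exp (-x ^ 2) from funext fun x => (hasDerivAt_erf x).deriv]
  fun_prop

lemma erf_neg (x : ℝ) : erf (-x) = -erf x := by
  have h := intervalIntegral.integral_comp_neg (a := 0) (b := x) fun t : ℝ => exp (-t ^ 2)
  simp only [neg_sq, neg_zero] at h
  rw [intervalIntegral.integral_symm 0 (-x)] at h
  simp only [erf]
  linear_combination (2 / √π) * h

lemma erf_pos {x : ℝ} (hx : 0 < x) : 0 < erf x := by
  have hc : Continuous fun t : ℝ => exp (-t ^ 2) := by fun_prop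
  exact mul_pos (by positivity) (intervalIntegral.intervalIntegral_pos_of_pos
    (hc.intervalIntegrable 0 x) (fun _ => exp_pos _) hx)

lemma b0_neg {Icut : ℝ → ℝ} (hcont : Continuous Icut) (hnonneg : ∀ x, 0 ≤ Icut x)
    (hone : Icut 1 = 1) : b0 Icut < 0 := by
  have hk : ∀ x ∈ Ioc (0 : ℝ) 2, 1 / (x + 5) ^ 3 < 1 / (-x + 5) ^ 3 := fun x hx =>
    one_div_lt_one_div_of_lt (pow_pos (by linarith [hx.2]) 3)
      (pow_lt_pow_left₀ (by linarith [hx.1]) (by linarith [hx.2]) (by norm_num))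
  have hpos : 0 < ∫ x in (0 : ℝ)..2, -((1 / (x + 5) ^ 3 - 1 / (-x + 5) ^ 3) * erf x * Icut x) := by
    refine intervalIntegral.integral_pos (by norm_num) ?_ ?_ ⟨1, by norm_num, ?_⟩
    · have herf : Continuous erf := contDiff_erf.continuous
      refine ContinuousOn.neg (ContinuousOn.mul (ContinuousOn.mul (ContinuousOn.sub ?_ ?_)
        herf.continuousOn) hcont.continuousOn)
      · refine ContinuousOn.div (by fun_prop) (by fun_prop) fun x hx => ?_
        have : 0 < x + 5 := by linarith [hx.1]
        positivity
      · refine ContinuousOn.div (by fun_prop) (by fun_prop) fun x hx => ?_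
        have : 0 < -x + 5 := by linarith [hx.2]
        positivity
    · intro x hx
      have h := mul_nonneg (mul_nonneg (sub_nonneg.2 (hk x hx).le) (erf_pos hx.1).le) (hnonneg x)
      linarith
    · have h := mul_pos (sub_pos.2 (hk 1 (by norm_num))) (erf_pos one_pos)
      rw [hone]
      linarith
  rw [intervalIntegral.integral_neg] at hpos
  rw [b0]
  linarith

lemma eq_zero_of_eventuallyEq_zero {f : ℝ → ℝ} {x : ℝ} (n : ℕ) (h : f =ᶠ[nhds x] fun _ => 0) :
    iteratedDeriv n f x = 0 := by
  rw [h.iteratedDeriv_eq n, iteratedDeriv_const]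
  split_ifs <;> rfl

/-- Integrating by parts twice moves the derivatives of a compactly supported `G` onto the kernel. -/
lemma integral_iteratedDeriv_two_div {G : ℝ → ℝ} (hG : ContDiff ℝ 2 G)
    (hzero : ∀ x : ℝ, 2 ≤ |x| → G x = 0) (hodd : ∀ x, G (-x) = -G x) :
    ∫ t, iteratedDeriv 2 G t / (t + 5) =
      2 * ∫ x in (0 : ℝ)..2, (1 / (x + 5) ^ 3 - 1 / (-x + 5) ^ 3) * G x := by
  have hev : ∀ x : ℝ, 2 < |x| → G =ᶠ[nhds x] fun _ => 0 := fun x hx => by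
    filter_upwards [(isOpen_lt continuous_const continuous_abs).mem_nhds hx] with y hy
    exact hzero y (le_of_lt hy)
  have hd1 : ∀ x, HasDerivAt G (iteratedDeriv 1 G x) x := fun x => by
    rw [iteratedDeriv_one]
    exact ((hG.differentiable (by norm_num)) x).hasDerivAt
  have hd2 : ∀ x, HasDerivAt (iteratedDeriv 1 G) (iteratedDeriv 2 G x) x := fun x => by
    rw [iteratedDeriv_succ (n := 1)]
    exact ((hG.differentiable_iteratedDeriv 1 (by norm_num)) x).hasDerivAt
  have hc2 : Continuous (iteratedDeriv 2 G) := hG.continuous_iteratedDeriv 2 le_rfl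
  have hne : ∀ t ∈ uIcc (-3 : ℝ) 3, 0 < t + 5 := fun t ht => by
    rw [uIcc_of_le (by norm_num)] at ht
    linarith [ht.1]
  have hi1 : IntervalIntegrable (fun t => iteratedDeriv 2 G t / (t + 5)) volume (-3) 3 :=
    (ContinuousOn.div hc2.continuousOn (by fun_prop) fun t ht => (hne t ht).ne').intervalIntegrable
  have hcont : ContinuousOn (fun t => 2 * G t / (t + 5) ^ 3) (uIcc (-3 : ℝ) 3) :=
    ContinuousOn.div (hG.continuous.const_mul 2 |>.continuousOn) (by fun_prop) fun t ht =>
      (pow_pos (hne t ht) 3).ne'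
  have hi2 : IntervalIntegrable (fun t => 2 * G t / (t + 5) ^ 3) volume (-3) 3 :=
    hcont.intervalIntegrable
  have hsub : ∀ {c d : ℝ}, -3 ≤ c → c ≤ 3 → -3 ≤ d → d ≤ 3 →
      IntervalIntegrable (fun t => 2 * G t / (t + 5) ^ 3) volume c d := fun h1 h2 h3 h4 =>
    (hcont.mono (uIcc_subset_uIcc (by simp [h1, h2]) (by simp [h3, h4]))).intervalIntegrable
  have hparts : ∫ t in (-3 : ℝ)..3, (iteratedDeriv 2 G t / (t + 5) - 2 * G t / (t + 5) ^ 3) = 0 := by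
    rw [intervalIntegral.integral_eq_sub_of_hasDerivAt
      (f := fun t => iteratedDeriv 1 G t / (t + 5) + G t / (t + 5) ^ 2) _ (hi1.sub hi2)]
    · simp [hzero 3 (by norm_num), hzero (-3) (by norm_num),
        eq_zero_of_eventuallyEq_zero 1 (hev 3 (by norm_num)),
        eq_zero_of_eventuallyEq_zero 1 (hev (-3) (by norm_num)), -iteratedDeriv_one]
    · intro t ht
      have h0 := (hne t ht).ne'
      have hl : HasDerivAt (fun t : ℝ => t + 5) 1 t := (hasDerivAt_id t).add_const 5
      refine (((hd2 t).div hl h0).add ((hd1 t).div (hl.pow 2) (pow_ne_zero 2 h0))).congr_deriv ?_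
      simp only [Pi.pow_apply]
      field_simp
      push_cast
      ring
  rw [intervalIntegral.integral_sub hi1 hi2, sub_eq_zero] at hparts
  have hfull : ∫ t, iteratedDeriv 2 G t / (t + 5) =
      ∫ t in (-3 : ℝ)..3, iteratedDeriv 2 G t / (t + 5) := by
    rw [intervalIntegral.integral_of_le (by norm_num)]
    refine (setIntegral_eq_integral_of_forall_compl_eq_zero fun t ht => ?_).symm
    rw [eq_zero_of_eventuallyEq_zero 2 (hev t _), zero_div]
    by_contra! h
    have := abs_le.1 h
    exact ht ⟨by linarith, by linarith⟩
  have htail : ∀ {c d : ℝ}, (∀ t ∈ uIcc c d, 2 ≤ |t|) →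
      ∫ t in c..d, 2 * G t / (t + 5) ^ 3 = 0 := fun h => by
    rw [intervalIntegral.integral_congr (g := fun _ => 0) fun t ht => by simp [hzero t (h t ht)]]
    simp
  have hleft : ∫ t in (-3 : ℝ)..(-2), 2 * G t / (t + 5) ^ 3 = 0 := htail fun t ht => by
    rw [uIcc_of_le (by norm_num)] at ht
    exact le_abs.2 (Or.inr (by linarith [ht.2]))
  have hright : ∫ t in (2 : ℝ)..3, 2 * G t / (t + 5) ^ 3 = 0 := htail fun t ht => by
    rw [uIcc_of_le (by norm_num)] at ht
    exact le_abs.2 (Or.inl ht.1)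
  have hneg : ∫ t in (-2 : ℝ)..0, 2 * G t / (t + 5) ^ 3 =
      ∫ t in (0 : ℝ)..2, -(2 * G t / (-t + 5) ^ 3) := by
    rw [← neg_zero, ← intervalIntegral.integral_comp_neg]
    simp only [hodd, mul_neg, neg_div, neg_zero]
  have hineg : IntervalIntegrable (fun t => -(2 * G t / (-t + 5) ^ 3)) volume 0 2 := by
    refine (ContinuousOn.neg (ContinuousOn.div (hG.continuous.const_mul 2 |>.continuousOn)
      (by fun_prop) fun t ht => ?_)).intervalIntegrable
    rw [uIcc_of_le (by norm_num)] at ht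
    have : 0 < -t + 5 := by linarith [ht.2]
    positivity
  rw [hfull, hparts,
    ← intervalIntegral.integral_add_adjacent_intervals (b := -2) (hsub _ _ _ _) (hsub _ _ _ _),
    ← intervalIntegral.integral_add_adjacent_intervals (a := -2) (b := 0) (hsub _ _ _ _) (hsub _ _ _ _),
    ← intervalIntegral.integral_add_adjacent_intervals (a := 0) (b := 2) (hsub _ _ _ _) (hsub _ _ _ _),
    hleft, hright, hneg, zero_add, add_zero, ← intervalIntegral.integral_add hineg (hsub _ _ _ _),
    ← intervalIntegral.integral_const_mul]
  · refine intervalIntegral.integral_congr fun t _ => ?_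
    ring
  all_goals norm_num

/-- On the unit interval `y log² (y² + γ²)` is bounded uniformly in `γ ∈ (0, 1]`. -/
lemma exists_abs_mul_log_sq_le : ∃ B : ℝ, 0 ≤ B ∧ ∀ γ y : ℝ, 0 < γ → γ ≤ 1 → |y| ≤ 1 →
    |y| * log (y ^ 2 + γ ^ 2) ^ 2 ≤ B := by
  obtain ⟨B, hB⟩ := (isCompact_Icc (a := (0 : ℝ)) (b := 2)).exists_bound_of_continuousOn
    continuous_mul_log.continuousOn
  refine ⟨16 * B ^ 2, by positivity, fun γ y hγ hγ1 hy => ?_⟩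
  have hs : 0 < y ^ 2 + γ ^ 2 := by positivity
  have hs2 : y ^ 2 + γ ^ 2 ≤ 2 := by nlinarith [sq_abs y, abs_nonneg y]
  set x := √√(y ^ 2 + γ ^ 2) with hx
  have hx2 : x ^ 2 = √(y ^ 2 + γ ^ 2) := sq_sqrt (sqrt_nonneg _)
  have hlog : log (y ^ 2 + γ ^ 2) = 4 * log x := by
    rw [hx, log_sqrt (sqrt_nonneg _), log_sqrt hs.le]
    ring
  have hyx : |y| ≤ x ^ 2 := by
    rw [hx2]
    exact abs_le_sqrt (by nlinarith)
  have hx0 : 0 ≤ x := sqrt_nonneg _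
  have hxle : x ≤ 2 := by
    have : x ^ 2 ≤ 2 := by
      rw [hx2]
      exact sqrt_le_iff.2 ⟨by norm_num, by linarith⟩
    nlinarith
  have hb := hB x ⟨hx0, hxle⟩
  calc |y| * log (y ^ 2 + γ ^ 2) ^ 2 ≤ x ^ 2 * log (y ^ 2 + γ ^ 2) ^ 2 := by gcongr
    _ = 16 * (x * log x) ^ 2 := by rw [hlog]; ring
    _ ≤ 16 * B ^ 2 := by
      rw [Real.norm_eq_abs] at hb
      nlinarith [sq_abs (x * log x), abs_nonneg (x * log x)]

/-- A Riccati barrier `P` bounds the quadratic form of `q` from below. -/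
lemma neg_le_of_mem_rqSet {q P P' : ℝ → ℝ} {C r : ℝ} (hP : ∀ y, HasDerivAt P (P' y) y)
    (hP' : Continuous P') (hq : ∀ y ∈ Icc (-1 : ℝ) 1, -C ≤ q y + P' y - P y ^ 2)
    (hr : r ∈ rqSet q) : -C ≤ r := by
  obtain ⟨φ, dφ, hφ, hl, hr, hi, hqi, hnorm, rfl⟩ := hr
  have hφc : Continuous φ := continuous_iff_continuousAt.2 fun y => (hφ y).continuousAt
  have hPc : Continuous P := continuous_iff_continuousAt.2 fun y => (hP y).continuousAt
  have hdm : Measurable dφ := by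
    rw [show dφ = deriv φ from funext fun y => (hφ y).deriv.symm]
    exact measurable_deriv φ
  have hdi : IntervalIntegrable dφ volume (-1) 1 := by
    refine ((intervalIntegrable_const (c := (1 : ℝ))).add hi).mono_fun'
      hdm.aestronglyMeasurable (Eventually.of_forall fun y => ?_)
    simp only [Real.norm_eq_abs]
    nlinarith [sq_abs (dφ y), sq_nonneg (|dφ y| - 1), abs_nonneg (dφ y)]
  have hi1 : IntervalIntegrable (fun y => P' y * φ y ^ 2 + P y * (2 * φ y) * dφ y)
      volume (-1) 1 :=
    ((hP'.mul (hφc.pow 2)).intervalIntegrable _ _).add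
      (hdi.continuousOn_mul (hPc.mul (hφc.const_mul 2)).continuousOn)
  have hparts : ∫ y in (-1 : ℝ)..1, (P' y * φ y ^ 2 + P y * (2 * φ y) * dφ y) = 0 := by
    rw [intervalIntegral.integral_eq_sub_of_hasDerivAt (f := fun y => P y * φ y ^ 2) _ hi1]
    · simp [hl, hr]
    · intro y _
      refine ((hP y).mul ((hφ y).pow 2)).congr_deriv ?_
      simp only [Pi.pow_apply]
      push_cast
      ring
  have hi2 : IntervalIntegrable (fun y => C * φ y ^ 2) volume (-1) 1 :=
    ((hφc.pow 2).const_mul C).intervalIntegrable _ _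
  have key : ∫ y in (-1 : ℝ)..1, ((-1) * (P' y * φ y ^ 2 + P y * (2 * φ y) * dφ y) - C * φ y ^ 2) ≤
      ∫ y in (-1 : ℝ)..1, (dφ y ^ 2 + q y * φ y ^ 2) := by
    refine intervalIntegral.integral_mono_on (by norm_num) ((hi1.const_mul (-1)).sub hi2) (hi.add hqi)
      fun y hy => ?_
    nlinarith [sq_nonneg (dφ y + P y * φ y),
      mul_le_mul_of_nonneg_right (hq y hy) (sq_nonneg (φ y))]
  rwa [intervalIntegral.integral_sub (hi1.const_mul (-1)) hi2, intervalIntegral.integral_const_mul, hparts,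
    intervalIntegral.integral_const_mul, hnorm, mul_one, mul_zero, zero_sub] at key

lemma exists_uniform_lower_bound (β K : ℝ) (hK : 0 ≤ K) : ∃ C : ℝ, ∀ γ : ℝ, 0 < γ → γ ≤ 1 →
    ∀ q : ℝ → ℝ, (∀ y, |q y + β * y / (y ^ 2 + γ ^ 2)| ≤ K * γ / (y ^ 2 + γ ^ 2)) →
      ∀ r ∈ rqSet q, -C ≤ r := by
  obtain ⟨B, hB0, hB⟩ := exists_abs_mul_log_sq_le
  refine ⟨2 * (K * 2 + β ^ 2 * (B + 8)) ^ 2, fun γ hγ hγ1 q hq r hr => ?_⟩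
  have hs : ∀ y, 0 < y ^ 2 + γ ^ 2 := fun y => by positivity
  have hL : ∀ y, HasDerivAt (fun y => log (y ^ 2 + γ ^ 2)) (2 * y / (y ^ 2 + γ ^ 2)) y := fun y => by
    refine ((((hasDerivAt_id' y).pow 2).add_const (γ ^ 2)).log (hs y).ne').congr_deriv ?_
    simp
  have hA : ∀ y, HasDerivAt (fun y => arctan (y / γ)) (γ / (y ^ 2 + γ ^ 2)) y := fun y => by
    refine ((hasDerivAt_id' y).div_const γ).arctan.congr_deriv ?_
    have := (hs y).ne'
    rw [show 1 + (y / γ) ^ 2 = (y ^ 2 + γ ^ 2) / γ ^ 2 by field_simp; ring]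
    field_simp
  refine neg_le_of_mem_rqSet
    (P := fun y => β / 2 * log (y ^ 2 + γ ^ 2) + (K * arctan (y / γ) +
      β ^ 2 * (y * log (y ^ 2 + γ ^ 2) ^ 2 + 8 * y)))
    (P' := fun y => β / 2 * (2 * y / (y ^ 2 + γ ^ 2)) + (K * (γ / (y ^ 2 + γ ^ 2)) +
      β ^ 2 * (log (y ^ 2 + γ ^ 2) ^ 2 + 4 * log (y ^ 2 + γ ^ 2) * (y ^ 2 / (y ^ 2 + γ ^ 2)) + 8)))
    (fun y => ?_) ?_ (fun y hy => ?_) hr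
  · have hR := ((hasDerivAt_id' y).mul ((hL y).pow 2)).add ((hasDerivAt_id' y).const_mul 8)
    refine (((hL y).const_mul (β / 2)).add
      (((hA y).const_mul K).add (hR.const_mul (β ^ 2)))).congr_deriv ?_
    simp only [Pi.pow_apply]
    push_cast
    ring
  · have h0 : ∀ y, y ^ 2 + γ ^ 2 ≠ 0 := fun y => (hs y).ne'
    have hlog : Continuous fun y => log (y ^ 2 + γ ^ 2) := Continuous.log (by fun_prop) h0
    fun_prop (disch := assumption)
  · have hy1 : |y| ≤ 1 := abs_le.2 hy
    set L := log (y ^ 2 + γ ^ 2) with hLdef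
    have hθ0 : 0 ≤ y ^ 2 / (y ^ 2 + γ ^ 2) := by positivity
    have hθ1 : y ^ 2 / (y ^ 2 + γ ^ 2) ≤ 1 := (div_le_one (hs y)).2 (by nlinarith)
    have hR' : L ^ 2 / 2 ≤ L ^ 2 + 4 * L * (y ^ 2 / (y ^ 2 + γ ^ 2)) + 8 := by
      nlinarith [sq_nonneg (L + 4 * (y ^ 2 / (y ^ 2 + γ ^ 2)))]
    have hq1 : -(K * (γ / (y ^ 2 + γ ^ 2))) ≤ q y + β / 2 * (2 * y / (y ^ 2 + γ ^ 2)) := by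
      have := (abs_le.1 (hq y)).1
      ring_nf at this ⊢
      linarith
    have hX : |K * arctan (y / γ) + β ^ 2 * (y * L ^ 2 + 8 * y)| ≤ K * 2 + β ^ 2 * (B + 8) := by
      refine (abs_add_le _ _).trans (add_le_add ?_ ?_)
      · rw [abs_mul, abs_of_nonneg hK]
        refine mul_le_mul_of_nonneg_left (abs_le.2 ⟨?_, ?_⟩) hK
        · linarith [neg_pi_div_two_lt_arctan (y / γ), pi_lt_four]
        · linarith [arctan_lt_pi_div_two (y / γ), pi_lt_four]
      · rw [abs_mul, abs_of_nonneg (sq_nonneg β)]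
        refine mul_le_mul_of_nonneg_left ((abs_add_le _ _).trans (add_le_add ?_ ?_)) (sq_nonneg β)
        · rw [abs_mul, abs_of_nonneg (sq_nonneg L)]
          exact hB γ y hγ hγ1 hy1
        · rw [abs_mul, abs_of_pos (by norm_num : (0 : ℝ) < 8)]
          linarith
    have hX2 := sq_le_sq' (abs_le.1 hX).1 (abs_le.1 hX).2
    have hβ := mul_le_mul_of_nonneg_left hR' (sq_nonneg β)
    set X := K * arctan (y / γ) + β ^ 2 * (y * L ^ 2 + 8 * y)
    nlinarith [sq_nonneg (β / 2 * L - X)]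

/-- The modification of the linear shear in the inner variable `x = y / γ`, so that
`U_{γ,a}(y) = y + γ² V(y / γ)`. -/
noncomputable def innerProfile (Icut : ℝ → ℝ) (β a x : ℝ) : ℝ :=
  β / 2 * x ^ 2 * Icut x + a * (erf (x - 5) * Icut (x - 5))

/-- The Rayleigh–Kuo potential in the inner variable, multiplied by `γ`. -/
noncomputable def innerPotential (V : ℝ → ℝ) (β γ x : ℝ) : ℝ :=
  (iteratedDeriv 2 V x - β) / (x + γ * V x)

lemma contDiff_erf_mul {Icut : ℝ → ℝ} (hI : ContDiff ℝ (⊤ : ℕ∞) Icut) :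
    ContDiff ℝ 2 fun x => erf x * Icut x :=
  contDiff_infty.1 (contDiff_erf.mul hI) 2

lemma contDiff_innerProfile {Icut : ℝ → ℝ} (hI : ContDiff ℝ (⊤ : ℕ∞) Icut) (β a : ℝ) :
    ContDiff ℝ 2 (innerProfile Icut β a) := by
  have hI2 : ContDiff ℝ 2 Icut := contDiff_infty.1 hI 2
  have hG := (contDiff_erf_mul hI).comp (contDiff_id.sub (contDiff_const (c := (5 : ℝ))))
  exact ((contDiff_const.mul (contDiff_id.pow 2)).mul hI2).add (contDiff_const.mul hG)

lemma rayleighKuo_potential_eq {Icut : ℝ → ℝ} (hI : ContDiff ℝ (⊤ : ℕ∞) Icut) (β a : ℝ) {γ : ℝ}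
    (hγ : 0 < γ) (y : ℝ) :
    (iteratedDeriv 2 (Uprof Icut β γ a) y - β) / Uprof Icut β γ a y =
      γ⁻¹ * innerPotential (innerProfile Icut β a) β γ (γ⁻¹ * y) := by
  have hV := contDiff_innerProfile hI β a
  have hU : Uprof Icut β γ a = (fun y => y) + fun y =>
      γ ^ 2 * innerProfile Icut β a (γ⁻¹ * y) := by
    ext y
    have h5 : (y - 5 * γ) / γ = γ⁻¹ * y - 5 := by field_simp
    have h1 : y / γ = γ⁻¹ * y := by field_simp
    simp only [Uprof, innerProfile, Pi.add_apply, h5, h1]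
    field_simp
    ring
  have hVγ : ContDiff ℝ 2 fun y => innerProfile Icut β a (γ⁻¹ * y) :=
    hV.comp (contDiff_const.mul contDiff_id)
  have hU2 : iteratedDeriv 2 (Uprof Icut β γ a) y =
      iteratedDeriv 2 (innerProfile Icut β a) (γ⁻¹ * y) := by
    rw [hU, iteratedDeriv_add (f := fun y => y) contDiff_id.contDiffAt (contDiff_const.mul hVγ).contDiffAt,
      iteratedDeriv_const_mul_field, iteratedDeriv_comp_const_mul hV]
    have hid : iteratedDeriv 2 (fun y : ℝ => y) y = 0 := by
      simp [iteratedDeriv_succ]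
    rw [hid, zero_add, ← mul_assoc, ← mul_pow, mul_inv_cancel₀ hγ.ne', one_pow, one_mul]
  rw [hU2, hU, innerPotential]
  simp only [Pi.add_apply]
  rw [show y + γ ^ 2 * innerProfile Icut β a (γ⁻¹ * y) =
    γ * (γ⁻¹ * y + γ * innerProfile Icut β a (γ⁻¹ * y)) by field_simp, mul_comm γ, ← div_div,
    div_eq_inv_mul]

section InnerPotential

variable {V : ℝ → ℝ} {β : ℝ}

lemma exists_innerProfile_bound (hV : ContDiff ℝ 2 V)
    (hin : ∀ x, |x| ≤ 1 → V x = β / 2 * x ^ 2) (hout : ∀ x, 7 ≤ |x| → V x = 0) :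
    ∃ M, 0 ≤ M ∧ ∀ x, |V x| ≤ M * |x| ∧ |iteratedDeriv 2 V x - β| ≤ M := by
  obtain ⟨A, hA⟩ := (isCompact_Icc (a := (-7 : ℝ)) (b := 7)).exists_bound_of_continuousOn
    hV.continuous.continuousOn
  obtain ⟨B, hB⟩ := (isCompact_Icc (a := (-7 : ℝ)) (b := 7)).exists_bound_of_continuousOn
    (hV.continuous_iteratedDeriv 2 le_rfl).continuousOn
  simp only [Real.norm_eq_abs] at hA hB
  have hA0 := (abs_nonneg _).trans (hA 0 (by norm_num))
  have hB0 := (abs_nonneg _).trans (hB 0 (by norm_num))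
  have hβ0 := abs_nonneg β
  refine ⟨A + B + |β|, by positivity, fun x => ⟨?_, ?_⟩⟩
  · rcases le_total |x| 1 with hx | hx
    · rw [hin x hx, abs_mul, abs_div, abs_pow, abs_two]
      have : |x| ^ 2 ≤ |x| := by nlinarith [abs_nonneg x]
      nlinarith [abs_nonneg x, mul_nonneg hA0 (abs_nonneg x), mul_nonneg hB0 (abs_nonneg x),
        mul_le_mul_of_nonneg_left this hβ0, mul_nonneg hβ0 (abs_nonneg x)]
    · rcases le_total |x| 7 with h7 | h7
      · have := hA x (abs_le.1 h7)
        nlinarith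
      · rw [hout x h7, abs_zero]
        positivity
  · refine (abs_sub _ _).trans ?_
    rcases le_or_gt |x| 7 with h7 | h7
    · linarith [hB x (abs_le.1 h7)]
    · rw [eq_zero_of_eventuallyEq_zero 2, abs_zero]
      · linarith
      · filter_upwards [(isOpen_lt continuous_const continuous_abs).mem_nhds h7] with y hy
        exact hout y (le_of_lt hy)

lemma iteratedDeriv_two_eq_of_abs_lt_one (hin : ∀ x, |x| ≤ 1 → V x = β / 2 * x ^ 2) {x : ℝ}
    (hx : |x| < 1) : iteratedDeriv 2 V x = β := by
  have h : V =ᶠ[nhds x] fun x => β / 2 * x ^ 2 := by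
    filter_upwards [(isOpen_lt continuous_abs continuous_const).mem_nhds hx] with y hy
    exact hin y (le_of_lt hy)
  rw [h.iteratedDeriv_eq 2, iteratedDeriv_const_mul_field]
  simp

lemma half_abs_le_abs_add {γ M v x : ℝ} (hγ : 0 ≤ γ) (hγM : γ * M ≤ 1 / 2) (hv : |v| ≤ M * |x|) :
    |x| / 2 ≤ |x + γ * v| := by
  have h1 : |γ * v| ≤ |x| / 2 := by
    rw [abs_mul, abs_of_nonneg hγ]
    nlinarith [abs_nonneg x, mul_le_mul_of_nonneg_left hv hγ,
      mul_le_mul_of_nonneg_right hγM (abs_nonneg x)]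
  have h2 := abs_sub_abs_le_abs_sub x (-(γ * v))
  rw [abs_neg, sub_neg_eq_add] at h2
  linarith

lemma abs_innerPotential_add_le (hin : ∀ x, |x| ≤ 1 → V x = β / 2 * x ^ 2)
    (hout : ∀ x, 7 ≤ |x| → V x = 0) {M : ℝ} (hM0 : 0 ≤ M)
    (hM : ∀ x, |V x| ≤ M * |x| ∧ |iteratedDeriv 2 V x - β| ≤ M) {γ : ℝ} (hγ : 0 ≤ γ)
    (hγM : γ * M ≤ 1 / 2) (x : ℝ) :
    |innerPotential V β γ x + β * x / (x ^ 2 + 1)| ≤ (100 * M + 50 * |β|) / (x ^ 2 + 1) := by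
  have hs : 0 < x ^ 2 + 1 := by positivity
  have hβ0 := abs_nonneg β
  rw [innerPotential]
  rcases lt_or_ge |x| 1 with hx | hx
  · rw [iteratedDeriv_two_eq_of_abs_lt_one hin hx, sub_self, zero_div, zero_add, abs_div,
      abs_of_pos hs, abs_mul]
    gcongr
    nlinarith
  rcases le_or_gt |x| 7 with h7 | h7
  · have hd := half_abs_le_abs_add hγ hγM (hM x).1
    have h1 : |(iteratedDeriv 2 V x - β) / (x + γ * V x)| ≤ 2 * M := by
      rw [abs_div, div_le_iff₀ (by linarith)]
      nlinarith [(hM x).2]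
    have h2 : |β * x / (x ^ 2 + 1)| ≤ |β| := by
      rw [abs_div, abs_of_pos hs, abs_mul, div_le_iff₀ hs]
      exact mul_le_mul_of_nonneg_left (by nlinarith [sq_abs x]) hβ0
    have h3 : x ^ 2 + 1 ≤ 50 := by nlinarith [sq_abs x]
    refine (abs_add_le _ _).trans ((add_le_add h1 h2).trans ?_)
    rw [le_div_iff₀ hs]
    nlinarith
  · have hx0 : x ≠ 0 := abs_pos.1 (by linarith)
    have h2 : iteratedDeriv 2 V x = 0 := by
      refine eq_zero_of_eventuallyEq_zero 2 ?_
      filter_upwards [(isOpen_lt continuous_const continuous_abs).mem_nhds h7] with y hy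
      exact hout y (le_of_lt hy)
    rw [h2, hout x h7.le, mul_zero, add_zero, zero_sub, show -β / x + β * x / (x ^ 2 + 1) =
      -(β / x) / (x ^ 2 + 1) by field_simp; ring, abs_div, abs_of_pos hs, abs_neg, abs_div]
    gcongr
    rw [div_le_iff₀ (by linarith)]
    nlinarith

end InnerPotential

lemma innerProfile_of_abs_le_one {Icut : ℝ → ℝ} (hone : ∀ x ∈ Icc (-1 : ℝ) 1, Icut x = 1)
    (hzero : ∀ x : ℝ, 2 ≤ |x| → Icut x = 0) (β a : ℝ) {x : ℝ} (hx : |x| ≤ 1) :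
    innerProfile Icut β a x = β / 2 * x ^ 2 := by
  have h := abs_le.1 hx
  rw [innerProfile, hone x h, hzero (x - 5) (le_abs.2 (Or.inr (by linarith [h.2])))]
  ring

lemma innerProfile_of_seven_le_abs {Icut : ℝ → ℝ} (hzero : ∀ x : ℝ, 2 ≤ |x| → Icut x = 0)
    (β a : ℝ) {x : ℝ} (hx : 7 ≤ |x|) : innerProfile Icut β a x = 0 := by
  have h5 : 2 ≤ |x - 5| := by
    rcases le_abs.1 hx with h | h
    · exact le_abs.2 (Or.inl (by linarith))
    · exact le_abs.2 (Or.inr (by linarith))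
  rw [innerProfile, hzero x (by linarith), hzero _ h5]
  ring

lemma measurable_innerPotential {V : ℝ → ℝ} (hV : ContDiff ℝ 2 V) (β γ : ℝ) :
    Measurable (innerPotential V β γ) :=
  ((hV.continuous_iteratedDeriv 2 le_rfl).sub continuous_const).measurable.div
    (continuous_id.add (hV.continuous.const_mul γ)).measurable

lemma measurable_innerPotential_add {V : ℝ → ℝ} (hV : ContDiff ℝ 2 V) (β γ : ℝ) :
    Measurable fun x => innerPotential V β γ x + β * x / (x ^ 2 + 1) :=
  (measurable_innerPotential hV β γ).add (by fun_prop)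

lemma integrable_const_div_sq_add_one (K : ℝ) : Integrable fun x : ℝ => K / (x ^ 2 + 1) := by
  simpa [div_eq_mul_inv, add_comm] using integrable_inv_one_add_sq.const_mul K

lemma integral_eq_zero_of_odd {f : ℝ → ℝ} (hf : ∀ x, f (-x) = -f x) : ∫ x, f x = 0 := by
  have h := integral_neg_eq_self f volume
  simp only [hf, integral_neg] at h
  linarith

lemma integral_innerPotential_zero {Icut : ℝ → ℝ} (hI : ContDiff ℝ (⊤ : ℕ∞) Icut)
    (heven : ∀ x, Icut (-x) = Icut x) (hzero : ∀ x : ℝ, 2 ≤ |x| → Icut x = 0) (β a : ℝ)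
    (hint : Integrable fun x =>
      innerPotential (innerProfile Icut β a) β 0 x + β * x / (x ^ 2 + 1)) :
    ∫ x, (innerPotential (innerProfile Icut β a) β 0 x + β * x / (x ^ 2 + 1)) =
      b0 Icut * a := by
  set w : ℝ → ℝ := fun x => β / 2 * x ^ 2 * Icut x with hw
  set G : ℝ → ℝ := fun x => erf x * Icut x with hGdef
  have hG : ContDiff ℝ 2 G := contDiff_erf_mul hI
  have hw2 : ContDiff ℝ 2 w :=
    (contDiff_const.mul (contDiff_id.pow 2)).mul (contDiff_infty.1 hI 2)
  have hGz : ∀ x : ℝ, 2 ≤ |x| → G x = 0 := fun x hx => by simp [hGdef, hzero x hx]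
  have hGodd : ∀ x, G (-x) = -G x := fun x => by simp [hGdef, heven, erf_neg]
  have hweven : ∀ x, iteratedDeriv 2 w (-x) = iteratedDeriv 2 w x := fun x => by
    have h := iteratedDeriv_comp_neg 2 w x
    rw [show (fun x => w (-x)) = w from funext fun x => by simp [hw, heven]] at h
    simpa using h.symm
  have hV2 : ∀ x, iteratedDeriv 2 (innerProfile Icut β a) x =
      iteratedDeriv 2 w x + a * iteratedDeriv 2 G (x - 5) := fun x => by
    rw [show innerProfile Icut β a = w + fun x => a * G (x - 5) from rfl,
      iteratedDeriv_add (g := fun x => a * G (x - 5)) hw2.contDiffAt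
        (contDiff_const.mul (hG.comp (contDiff_id.sub contDiff_const))).contDiffAt,
      iteratedDeriv_const_mul_field, iteratedDeriv_comp_sub_const]
  have hcont : Continuous fun t => iteratedDeriv 2 G t / (t + 5) := by
    refine continuous_iff_continuousAt.2 fun t => ?_
    by_cases ht : t + 5 = 0
    · have hev : (fun t => iteratedDeriv 2 G t / (t + 5)) =ᶠ[nhds t] fun _ => 0 := by
        have h2 : 2 < |t| := lt_abs.2 (Or.inr (by linarith))
        filter_upwards [(isOpen_lt continuous_const continuous_abs).mem_nhds h2] with s hs
        rw [eq_zero_of_eventuallyEq_zero 2, zero_div]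
        filter_upwards [(isOpen_lt continuous_const continuous_abs).mem_nhds hs] with u hu
        exact hGz u (le_of_lt hu)
      exact hev.continuousAt
    · exact ContinuousAt.div (hG.continuous_iteratedDeriv 2 le_rfl).continuousAt
        (by fun_prop) ht
  have hsupp : HasCompactSupport fun t => iteratedDeriv 2 G t / (t + 5) := by
    refine HasCompactSupport.intro (isCompact_Icc (a := (-2 : ℝ)) (b := 2)) fun t ht => ?_
    have h2 : 2 < |t| := by
      by_contra! h
      exact ht (abs_le.1 h)
    rw [eq_zero_of_eventuallyEq_zero 2, zero_div]
    filter_upwards [(isOpen_lt continuous_const continuous_abs).mem_nhds h2] with u hu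
    exact hGz u (le_of_lt hu)
  have hshift : ∀ x, a * iteratedDeriv 2 G (x - 5) / x =
      a * (fun t => iteratedDeriv 2 G t / (t + 5)) (x - 5) := fun x => by
    simp only [sub_add_cancel, mul_div_assoc]
  have hint2 : Integrable fun x => a * iteratedDeriv 2 G (x - 5) / x := by
    simp only [hshift]
    exact ((hcont.integrable_of_hasCompactSupport hsupp).comp_sub_right 5).const_mul a
  have hodd : ∫ x, ((innerPotential (innerProfile Icut β a) β 0 x + β * x / (x ^ 2 + 1)) -
      a * iteratedDeriv 2 G (x - 5) / x) = 0 := by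
    have h : ∀ x, (innerPotential (innerProfile Icut β a) β 0 x + β * x / (x ^ 2 + 1)) -
        a * iteratedDeriv 2 G (x - 5) / x =
          (iteratedDeriv 2 w x - β) / x + β * x / (x ^ 2 + 1) := fun x => by
      rw [innerPotential, hV2, zero_mul, add_zero]
      ring
    simp only [h]
    refine integral_eq_zero_of_odd fun x => ?_
    rw [hweven, neg_sq, div_neg, mul_neg, neg_div]
    ring
  rw [integral_sub hint hint2, sub_eq_zero] at hodd
  rw [hodd]
  simp only [hshift]
  rw [integral_const_mul, integral_sub_right_eq_self (fun t => iteratedDeriv 2 G t / (t + 5)),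
    integral_iteratedDeriv_two_div hG hGz hGodd, b0, mul_comm]
  simp only [hGdef, mul_assoc]

section Limit

variable {V : ℝ → ℝ} {β : ℝ}

lemma tendsto_integral_innerPotential (hV : ContDiff ℝ 2 V)
    (hin : ∀ x, |x| ≤ 1 → V x = β / 2 * x ^ 2) {M K : ℝ}
    (hK : ∀ γ, 0 ≤ γ → γ * M ≤ 1 / 2 → ∀ x,
      |innerPotential V β γ x + β * x / (x ^ 2 + 1)| ≤ K / (x ^ 2 + 1))
    {ψ : ℝ → ℝ} (hψ : Continuous ψ) (hψ0 : ψ 0 = 1) (hψ1 : ∀ x, |ψ x| ≤ 1) :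
    Tendsto (fun γ => ∫ x, (innerPotential V β γ x + β * x / (x ^ 2 + 1)) * ψ (γ * x) ^ 2)
      (nhdsWithin 0 (Ioi 0))
      (nhds (∫ x, (innerPotential V β 0 x + β * x / (x ^ 2 + 1)))) := by
  have hsmall : ∀ᶠ γ : ℝ in nhdsWithin 0 (Ioi 0), γ * M ≤ 1 / 2 := by
    have h : Tendsto (fun γ : ℝ => γ * M) (nhdsWithin 0 (Ioi 0)) (nhds (0 * M)) :=
      ((continuous_id.mul continuous_const).tendsto 0).mono_left nhdsWithin_le_nhds
    rw [zero_mul] at h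
    exact h.eventually_le_const (by norm_num)
  refine tendsto_integral_filter_of_dominated_convergence (fun x => K / (x ^ 2 + 1))
    (Eventually.of_forall fun γ => ?_) ?_ (integrable_const_div_sq_add_one K)
    (Eventually.of_forall fun x => ?_)
  · exact ((measurable_innerPotential_add hV β γ).mul
      ((hψ.comp (continuous_const.mul continuous_id)).pow 2).measurable).aestronglyMeasurable
  · filter_upwards [hsmall, self_mem_nhdsWithin] with γ hγM hγ
    refine Eventually.of_forall fun x => ?_
    rw [Real.norm_eq_abs, abs_mul, abs_pow]
    exact (mul_le_of_le_one_right (abs_nonneg _)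
      (pow_le_one₀ (abs_nonneg _) (hψ1 _))).trans (hK γ (le_of_lt hγ) hγM x)
  · refine Tendsto.mono_left ?_ nhdsWithin_le_nhds
    have hψt : Tendsto (fun γ => ψ (γ * x) ^ 2) (nhds 0) (nhds 1) := by
      have h : Continuous fun γ => ψ (γ * x) ^ 2 := by fun_prop
      simpa [hψ0] using h.tendsto 0
    have hS : Tendsto (fun γ => innerPotential V β γ x) (nhds 0)
        (nhds (innerPotential V β 0 x)) := by
      by_cases hx : x = 0
      · have h : ∀ γ, innerPotential V β γ x = 0 := fun γ => by
          rw [innerPotential, iteratedDeriv_two_eq_of_abs_lt_one hin (by simp [hx]), sub_self,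
            zero_div]
        simp only [h]
        exact tendsto_const_nhds
      · have h : ContinuousAt (fun γ => innerPotential V β γ x) 0 :=
          continuousAt_const.div (by fun_prop) (by simpa using hx)
        exact h
    simpa using (hS.add_const (β * x / (x ^ 2 + 1))).mul hψt

/-- Testing with an even compactly supported function cancels the odd part of the potential. -/
lemma integrable_and_integral_innerPotential (hV : ContDiff ℝ 2 V) {γ K : ℝ} (hγ : 0 < γ)
    (hK : ∀ x, |innerPotential V β γ x + β * x / (x ^ 2 + 1)| ≤ K / (x ^ 2 + 1))
    {ψ : ℝ → ℝ} (hψ : Continuous ψ) (hψ1 : ∀ x, |ψ x| ≤ 1) (heven : ∀ x, ψ (-x) = ψ x)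
    (hsupp : ∀ x, 1 ≤ |x| → ψ x = 0) :
    Integrable (fun y => γ⁻¹ * innerPotential V β γ (γ⁻¹ * y) * ψ y ^ 2) ∧
      ∫ y, γ⁻¹ * innerPotential V β γ (γ⁻¹ * y) * ψ y ^ 2 =
        ∫ x, (innerPotential V β γ x + β * x / (x ^ 2 + 1)) * ψ (γ * x) ^ 2 := by
  have hsum : Integrable fun x =>
      (innerPotential V β γ x + β * x / (x ^ 2 + 1)) * ψ (γ * x) ^ 2 := by
    refine (integrable_const_div_sq_add_one K).mono' ((measurable_innerPotential_add hV β γ).mul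
      ((hψ.comp (continuous_const.mul continuous_id)).pow 2).measurable).aestronglyMeasurable
      (Eventually.of_forall fun x => ?_)
    rw [Real.norm_eq_abs, abs_mul, abs_pow]
    exact (mul_le_of_le_one_right (abs_nonneg _)
      (pow_le_one₀ (abs_nonneg _) (hψ1 _))).trans (hK x)
  have hoddint : Integrable fun x => β * x / (x ^ 2 + 1) * ψ (γ * x) ^ 2 := by
    have h0 : ∀ x : ℝ, x ^ 2 + 1 ≠ 0 := fun x => by positivity
    refine Continuous.integrable_of_hasCompactSupport (by fun_prop (disch := assumption)) ?_
    refine HasCompactSupport.intro (isCompact_Icc (a := -γ⁻¹) (b := γ⁻¹)) fun x hx => ?_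
    rw [hsupp (γ * x)]
    · ring
    · by_contra! h
      rw [abs_mul, abs_of_pos hγ, ← lt_inv_mul_iff₀ hγ, mul_one] at h
      exact hx (abs_le.1 h.le)
  have hpot : Integrable fun x => innerPotential V β γ x * ψ (γ * x) ^ 2 := by
    refine (hsum.sub hoddint).congr (Eventually.of_forall fun x => ?_)
    simp only [Pi.sub_apply]
    ring
  have hcomp : ∀ x, innerPotential V β γ x * ψ (γ * x) ^ 2 =
      (fun y => innerPotential V β γ (γ⁻¹ * y) * ψ y ^ 2) (γ * x) := fun x => by
    simp only [inv_mul_cancel_left₀ hγ.ne']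
  have hzero : ∫ x, β * x / (x ^ 2 + 1) * ψ (γ * x) ^ 2 = 0 :=
    integral_eq_zero_of_odd fun x => by
      rw [mul_neg γ, heven, neg_sq, mul_neg, neg_div, neg_mul]
  simp only [mul_assoc]
  refine ⟨?_, ?_⟩
  · refine Integrable.const_mul ?_ γ⁻¹
    rw [← integrable_comp_mul_left_iff _ hγ.ne']
    simpa only [← hcomp] using hpot
  · rw [integral_const_mul]
    have h := Measure.integral_comp_mul_left
      (fun y => innerPotential V β γ (γ⁻¹ * y) * ψ y ^ 2) γ
    rw [abs_of_pos (inv_pos.2 hγ), smul_eq_mul] at h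
    rw [← h]
    simp only [← hcomp, add_mul]
    rw [integral_add hpot hoddint, hzero, add_zero]

end Limit

lemma div_mem_rqSet {q φ dφ : ℝ → ℝ} (hφ : ∀ y, HasDerivAt φ (dφ y) y) (hl : φ (-1) = 0)
    (hr : φ 1 = 0) (hi : IntervalIntegrable (fun y => dφ y ^ 2) volume (-1) 1)
    (hq : IntervalIntegrable (fun y => q y * φ y ^ 2) volume (-1) 1)
    (hD : 0 < ∫ y in (-1 : ℝ)..1, φ y ^ 2) :
    ((∫ y in (-1 : ℝ)..1, dφ y ^ 2) + ∫ y in (-1 : ℝ)..1, q y * φ y ^ 2) /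
      (∫ y in (-1 : ℝ)..1, φ y ^ 2) ∈ rqSet q := by
  set D := ∫ y in (-1 : ℝ)..1, φ y ^ 2 with hDdef
  have h1 : ∀ y, (dφ y / √D) ^ 2 = dφ y ^ 2 / D := fun y => by rw [div_pow, sq_sqrt hD.le]
  have h2 : ∀ y, (φ y / √D) ^ 2 = φ y ^ 2 / D := fun y => by rw [div_pow, sq_sqrt hD.le]
  refine ⟨fun y => φ y / √D, fun y => dφ y / √D, fun y => (hφ y).div_const _, by simp [hl],
    by simp [hr], ?_, ?_, ?_, ?_⟩
  · simpa only [h1] using hi.div_const D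
  · simpa only [h2, mul_div_assoc] using hq.div_const D
  · simp only [h2]
    rw [intervalIntegral.integral_div, ← hDdef, div_self hD.ne']
  · simp only [h1, h2, ← mul_div_assoc, ← add_div]
    rw [intervalIntegral.integral_div, intervalIntegral.integral_add hi hq]

section TestFunction

variable {p : ℝ}

lemma hasDerivAt_one_sub_abs_rpow (hp : 1 < p) (y : ℝ) :
    HasDerivAt (fun y : ℝ => 1 - |y| ^ p) (-(p * |y| ^ (p - 2) * y)) y :=
  (hasDerivAt_abs_rpow y hp).const_sub 1

lemma sq_deriv_one_sub_abs_rpow_le (hp : 1 < p) {y : ℝ} (hy : |y| ≤ 1) :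
    (-(p * |y| ^ (p - 2) * y)) ^ 2 ≤ p ^ 2 := by
  rcases eq_or_ne y 0 with rfl | hy0
  · simpa using sq_nonneg p
  have hpos : 0 < |y| := abs_pos.2 hy0
  have h : |(-(p * |y| ^ (p - 2) * y))| = p * |y| ^ (p - 1) := by
    rw [abs_neg, abs_mul, abs_mul, abs_of_pos (by linarith : 0 < p),
      abs_of_pos (rpow_pos_of_pos hpos _), mul_assoc, ← rpow_add_one hpos.ne']
    congr 2
    ring
  rw [← sq_abs, h]
  have h1 : |y| ^ (p - 1) ≤ 1 := rpow_le_one hpos.le hy (by linarith)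
  have h0 : 0 ≤ |y| ^ (p - 1) := rpow_nonneg hpos.le _
  exact pow_le_pow_left₀ (by positivity) (mul_le_of_le_one_right (by linarith) h1) 2

lemma intervalIntegrable_sq_deriv_one_sub_abs_rpow (hp : 1 < p) :
    IntervalIntegrable (fun y : ℝ => (-(p * |y| ^ (p - 2) * y)) ^ 2) volume (-1) 1 := by
  refine (intervalIntegrable_const (c := p ^ 2)).mono_fun' (by fun_prop) ?_
  refine (ae_restrict_iff' measurableSet_uIoc).2 (Eventually.of_forall fun y hy => ?_)
  rw [uIoc_of_le (by norm_num)] at hy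
  refine (norm_of_nonneg (sq_nonneg _)).trans_le ?_
  exact sq_deriv_one_sub_abs_rpow_le hp (abs_le.2 ⟨hy.1.le, hy.2⟩)

lemma integral_sq_deriv_one_sub_abs_rpow_le (hp : 1 < p) :
    ∫ y in (-1 : ℝ)..1, (-(p * |y| ^ (p - 2) * y)) ^ 2 ≤ 2 * p ^ 2 := by
  have h := intervalIntegral.integral_mono_on (by norm_num)
    (intervalIntegrable_sq_deriv_one_sub_abs_rpow hp) (intervalIntegrable_const (c := p ^ 2))
    fun y hy => sq_deriv_one_sub_abs_rpow_le hp (abs_le.2 hy)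
  rw [intervalIntegral.integral_const, smul_eq_mul] at h
  linarith

lemma integral_one_sub_abs_sq : ∫ y in (-1 : ℝ)..1, (1 - |y|) ^ 2 = 2 / 3 := by
  have hi : ∀ c d : ℝ, IntervalIntegrable (fun y : ℝ => (1 - |y|) ^ 2) volume c d := fun c d =>
    Continuous.intervalIntegrable (by fun_prop) c d
  rw [← intervalIntegral.integral_add_adjacent_intervals (hi (-1) 0) (hi 0 1)]
  have hleft : ∫ y in (-1 : ℝ)..0, (1 - |y|) ^ 2 = ∫ y in (0 : ℝ)..1, (1 - |y|) ^ 2 := by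
    rw [← neg_zero, ← intervalIntegral.integral_comp_neg]
    simp
  have hright : ∫ y in (0 : ℝ)..1, (1 - |y|) ^ 2 = 1 / 3 := by
    rw [intervalIntegral.integral_congr (g := fun y => (1 - y) ^ 2) fun y hy => ?_,
      intervalIntegral.integral_comp_sub_left (fun y => y ^ 2)]
    · norm_num
    · rw [uIcc_of_le (by norm_num)] at hy
      simp only [abs_of_nonneg hy.1]
  rw [hleft, hright]
  norm_num

lemma continuous_one_sub_abs_rpow (hp : 1 < p) : Continuous fun y : ℝ => 1 - |y| ^ p :=
  continuous_iff_continuousAt.2 fun y => (hasDerivAt_one_sub_abs_rpow hp y).continuousAt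

lemma one_sub_abs_le_one_sub_abs_rpow (hp : 1 < p) {y : ℝ} (hy : |y| ≤ 1) :
    1 - |y| ≤ 1 - |y| ^ p := by
  have h := rpow_le_rpow_of_exponent_ge' (abs_nonneg y) hy zero_le_one hp.le
  rw [rpow_one] at h
  linarith

lemma integral_sq_one_sub_abs_rpow_mem (hp : 1 < p) :
    ∫ y in (-1 : ℝ)..1, (1 - |y| ^ p) ^ 2 ∈ Icc (2 / 3) (2 / 3 * p ^ 2) := by
  have hc := (continuous_one_sub_abs_rpow hp).pow 2
  have hc1 : Continuous fun y : ℝ => (1 - |y|) ^ 2 := by fun_prop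
  constructor
  · rw [← integral_one_sub_abs_sq]
    refine intervalIntegral.integral_mono_on (by norm_num) (hc1.intervalIntegrable _ _)
      (hc.intervalIntegrable _ _) fun y hy => ?_
    have hy1 := abs_le.2 hy
    exact pow_le_pow_left₀ (by linarith) (one_sub_abs_le_one_sub_abs_rpow hp hy1) 2
  · rw [← integral_one_sub_abs_sq, ← intervalIntegral.integral_mul_const]
    refine intervalIntegral.integral_mono_on (by norm_num) (hc.intervalIntegrable _ _)
      ((hc1.mul_const _).intervalIntegrable _ _) fun y hy => ?_
    have hy1 := abs_le.2 hy
    have hb := one_add_mul_self_le_rpow_one_add (s := |y| - 1) (by linarith [abs_nonneg y]) hp.le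
    rw [add_sub_cancel] at hb
    rw [← mul_pow]
    have hle := one_sub_abs_le_one_sub_abs_rpow hp hy1
    exact pow_le_pow_left₀ (by linarith) (by linarith) 2

end TestFunction

lemma exists_exponent {b c : ℝ} (h : 3 + 3 / 2 * b < c) :
    ∃ p : ℝ, 1 < p ∧ ∀ D ∈ Icc (2 / 3) (2 / 3 * p ^ 2), 2 * p ^ 2 + b < c * D := by
  have h1 : Tendsto (fun p : ℝ => 2 * p ^ 2 + b - c * (2 / 3)) (nhdsWithin 1 (Ioi 1))
      (nhds (2 * 1 ^ 2 + b - c * (2 / 3))) :=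
    (Continuous.tendsto (by fun_prop) 1).mono_left nhdsWithin_le_nhds
  have h2 : Tendsto (fun p : ℝ => 2 * p ^ 2 + b - c * (2 / 3 * p ^ 2)) (nhdsWithin 1 (Ioi 1))
      (nhds (2 * 1 ^ 2 + b - c * (2 / 3 * 1 ^ 2))) :=
    (Continuous.tendsto (by fun_prop) 1).mono_left nhdsWithin_le_nhds
  obtain ⟨p, ⟨hp1, hp2⟩, hp⟩ := (((h1.eventually_lt_const (by linarith : _ < (0 : ℝ))).and
    (h2.eventually_lt_const (by linarith : _ < (0 : ℝ)))).and self_mem_nhdsWithin).exists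
  refine ⟨p, hp, fun D hD => ?_⟩
  rcases le_total 0 c with hc | hc
  · linarith [mul_le_mul_of_nonneg_left hD.1 hc]
  · linarith [mul_le_mul_of_nonpos_left hD.2 hc]

/-- For a fixed test function `1 - |y|^p`, the potential part of the quadratic form converges. -/
lemma tendsto_integral_potential {V : ℝ → ℝ} {β M K p : ℝ} (hp : 1 < p) (hV : ContDiff ℝ 2 V)
    (hin : ∀ x, |x| ≤ 1 → V x = β / 2 * x ^ 2)
    (hK : ∀ γ, 0 ≤ γ → γ * M ≤ 1 / 2 → ∀ x,
      |innerPotential V β γ x + β * x / (x ^ 2 + 1)| ≤ K / (x ^ 2 + 1))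
    (hsmall : ∀ᶠ γ : ℝ in nhdsWithin 0 (Ioi 0), γ * M ≤ 1 / 2) :
    (∀ᶠ γ in nhdsWithin 0 (Ioi 0), IntervalIntegrable
      (fun y => γ⁻¹ * innerPotential V β γ (γ⁻¹ * y) * (1 - |y| ^ p) ^ 2) volume (-1) 1) ∧
    Tendsto (fun γ => ∫ y in (-1 : ℝ)..1,
        γ⁻¹ * innerPotential V β γ (γ⁻¹ * y) * (1 - |y| ^ p) ^ 2) (nhdsWithin 0 (Ioi 0))
      (nhds (∫ x, (innerPotential V β 0 x + β * x / (x ^ 2 + 1)))) := by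
  set ψ : ℝ → ℝ := fun y => max 0 (1 - |y| ^ p) with hψdef
  have hψ : Continuous ψ := continuous_const.max (continuous_one_sub_abs_rpow hp)
  have hψ1 : ∀ x, |ψ x| ≤ 1 := fun x => by
    rw [abs_of_nonneg (le_max_left _ _)]
    exact max_le zero_le_one (by linarith [rpow_nonneg (abs_nonneg x) p])
  have hψ0 : ψ 0 = 1 := by simp [hψdef, zero_rpow (by linarith : p ≠ 0)]
  have heven : ∀ x, ψ (-x) = ψ x := fun x => by simp [hψdef]
  have hsupp : ∀ x, 1 ≤ |x| → ψ x = 0 := fun x hx =>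
    max_eq_left (by linarith [one_le_rpow hx (by linarith : 0 ≤ p)])
  have heq : ∀ y ∈ Ioc (-1 : ℝ) 1, ψ y = 1 - |y| ^ p := fun y hy => by
    have hy1 : |y| ≤ 1 := abs_le.2 ⟨hy.1.le, hy.2⟩
    exact max_eq_right (by linarith [one_sub_abs_le_one_sub_abs_rpow hp hy1])
  have hfull : ∀ᶠ γ in nhdsWithin (0 : ℝ) (Ioi 0),
      IntervalIntegrable
        (fun y => γ⁻¹ * innerPotential V β γ (γ⁻¹ * y) * (1 - |y| ^ p) ^ 2) volume (-1) 1 ∧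
      ∫ x, (innerPotential V β γ x + β * x / (x ^ 2 + 1)) * ψ (γ * x) ^ 2 =
        ∫ y in (-1 : ℝ)..1, γ⁻¹ * innerPotential V β γ (γ⁻¹ * y) * (1 - |y| ^ p) ^ 2 := by
    filter_upwards [hsmall, self_mem_nhdsWithin] with γ hγM hγ
    obtain ⟨hi, he⟩ := integrable_and_integral_innerPotential hV hγ
      (hK γ (le_of_lt hγ) hγM) hψ hψ1 heven hsupp
    have hcongr : EqOn (fun y => γ⁻¹ * innerPotential V β γ (γ⁻¹ * y) * ψ y ^ 2)
        (fun y => γ⁻¹ * innerPotential V β γ (γ⁻¹ * y) * (1 - |y| ^ p) ^ 2) (Ioc (-1) 1) :=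
      fun y hy => by simp only [heq y hy]
    refine ⟨?_, ?_⟩
    · rw [intervalIntegrable_iff_integrableOn_Ioc_of_le (by norm_num)]
      exact hi.integrableOn.congr_fun hcongr measurableSet_Ioc
    · rw [← he, intervalIntegral.integral_of_le (by norm_num),
        ← setIntegral_congr_fun measurableSet_Ioc hcongr]
      refine (setIntegral_eq_integral_of_forall_compl_eq_zero fun y hy => ?_).symm
      rw [hsupp y]
      · ring
      · by_contra! h
        exact hy ⟨(abs_lt.1 h).1, (abs_lt.1 h).2.le⟩
  exact ⟨hfull.mono fun γ h => h.1, (tendsto_integral_innerPotential hV hin hK hψ hψ0 hψ1).congr'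
    (hfull.mono fun γ h => h.2)⟩

lemma exists_lam1_bounds {Icut : ℝ → ℝ} (hsmooth : ContDiff ℝ (⊤ : ℕ∞) Icut)
    (heven : ∀ x, Icut (-x) = Icut x) (hone : ∀ x ∈ Icc (-1 : ℝ) 1, Icut x = 1)
    (hzero : ∀ x : ℝ, 2 ≤ |x| → Icut x = 0) (β a : ℝ) :
    (∃ C, ∀ᶠ γ in nhdsWithin 0 (Ioi 0), C ≤ lam1 Icut β γ a) ∧
      ∀ c, 3 + 3 / 2 * (b0 Icut * a) < c →
        ∀ᶠ γ in nhdsWithin 0 (Ioi 0), lam1 Icut β γ a < c := by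
  set V := innerProfile Icut β a with hVdef
  have hV : ContDiff ℝ 2 V := contDiff_innerProfile hsmooth β a
  have hin : ∀ x, |x| ≤ 1 → V x = β / 2 * x ^ 2 := fun x hx =>
    innerProfile_of_abs_le_one hone hzero β a hx
  have hout : ∀ x, 7 ≤ |x| → V x = 0 := fun x hx => innerProfile_of_seven_le_abs hzero β a hx
  obtain ⟨M, hM0, hM⟩ := exists_innerProfile_bound hV hin hout
  set K := 100 * M + 50 * |β| with hKdef
  have hK0 : 0 ≤ K := by positivity
  have hK : ∀ γ, 0 ≤ γ → γ * M ≤ 1 / 2 → ∀ x,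
      |innerPotential V β γ x + β * x / (x ^ 2 + 1)| ≤ K / (x ^ 2 + 1) := fun γ hγ hγM =>
    abs_innerPotential_add_le hin hout hM0 hM hγ hγM
  have hsmall : ∀ᶠ γ : ℝ in nhdsWithin 0 (Ioi 0), γ * M ≤ 1 / 2 := by
    have h : Tendsto (fun γ : ℝ => γ * M) (nhdsWithin 0 (Ioi 0)) (nhds (0 * M)) :=
      (Continuous.tendsto (by fun_prop) 0).mono_left nhdsWithin_le_nhds
    rw [zero_mul] at h
    exact h.eventually_le_const (by norm_num)
  have hle1 : ∀ᶠ γ : ℝ in nhdsWithin 0 (Ioi 0), γ ≤ 1 :=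
    nhdsWithin_le_nhds (Iic_mem_nhds one_pos)
  have hlam : ∀ γ, 0 < γ → lam1 Icut β γ a =
      sInf (rqSet fun y => γ⁻¹ * innerPotential V β γ (γ⁻¹ * y)) := fun γ hγ => by
    simp only [lam1, rayleighKuo_potential_eq hsmooth β a hγ, hVdef]
  obtain ⟨C, hC⟩ := exists_uniform_lower_bound β K hK0
  have hlower : ∀ᶠ γ : ℝ in nhdsWithin 0 (Ioi 0),
      ∀ r ∈ rqSet fun y => γ⁻¹ * innerPotential V β γ (γ⁻¹ * y), -C ≤ r := by
    filter_upwards [hsmall, hle1, self_mem_nhdsWithin] with γ hγM hγ1 hγ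
    rw [mem_Ioi] at hγ
    refine hC γ hγ hγ1 _ fun y => ?_
    have h := mul_le_mul_of_nonneg_left (hK γ hγ.le hγM (γ⁻¹ * y)) (inv_pos.2 hγ).le
    have hs : y ^ 2 + γ ^ 2 ≠ 0 := by positivity
    have hs' : (γ⁻¹ * y) ^ 2 + 1 = (y ^ 2 + γ ^ 2) / γ ^ 2 := by field_simp
    rw [← abs_of_pos (inv_pos.2 hγ), ← abs_mul, abs_of_pos (inv_pos.2 hγ), hs'] at h
    have hodd : γ⁻¹ * (β * (γ⁻¹ * y) / ((y ^ 2 + γ ^ 2) / γ ^ 2)) = β * y / (y ^ 2 + γ ^ 2) := by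
      field_simp
    have hbound : γ⁻¹ * (K / ((y ^ 2 + γ ^ 2) / γ ^ 2)) = K * γ / (y ^ 2 + γ ^ 2) := by
      field_simp
    rwa [mul_add, hodd, hbound] at h
  have hupper : ∀ c, 3 + 3 / 2 * (b0 Icut * a) < c → ∀ᶠ γ in nhdsWithin 0 (Ioi 0),
      ∃ r ∈ rqSet fun y => γ⁻¹ * innerPotential V β γ (γ⁻¹ * y), r < c := fun c hc => by
    obtain ⟨p, hp, hpc⟩ := exists_exponent hc
    obtain ⟨hint, htend⟩ := tendsto_integral_potential hp hV hin hK hsmall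
    have hDmem := integral_sq_one_sub_abs_rpow_mem hp
    have hA := integral_sq_deriv_one_sub_abs_rpow_le hp
    have hDlt := hpc _ hDmem
    have hDpos : 0 < ∫ y in (-1 : ℝ)..1, (1 - |y| ^ p) ^ 2 := lt_of_lt_of_le (by norm_num) hDmem.1
    have hint0 : Integrable fun x => innerPotential V β 0 x + β * x / (x ^ 2 + 1) :=
      (integrable_const_div_sq_add_one K).mono'
        (measurable_innerPotential_add hV β 0).aestronglyMeasurable
        (Eventually.of_forall (hK 0 le_rfl (by norm_num)))
    rw [integral_innerPotential_zero hsmooth heven hzero β a hint0] at htend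
    filter_upwards [hint, htend.eventually_lt_const (lt_sub_iff_add_lt'.2 hDlt)] with γ hγi hγ
    refine ⟨_, div_mem_rqSet (hasDerivAt_one_sub_abs_rpow hp) (by simp) (by simp)
      (intervalIntegrable_sq_deriv_one_sub_abs_rpow hp) hγi hDpos, ?_⟩
    rw [div_lt_iff₀ hDpos]
    linarith
  refine ⟨⟨-C, ?_⟩, fun c hc => ?_⟩
  · filter_upwards [hlower, hupper _ (lt_add_one _), self_mem_nhdsWithin] with γ hl hu hγ
    obtain ⟨r, hr, -⟩ := hu
    rw [hlam γ hγ]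
    exact le_csInf ⟨r, hr⟩ hl
  · filter_upwards [hlower, hupper c hc, self_mem_nhdsWithin] with γ hl hu hγ
    obtain ⟨r, hr, hrc⟩ := hu
    rw [hlam γ hγ]
    exact (csInf_le ⟨-C, hl⟩ hr).trans_lt hrc

/-- For `β ≠ 0` and `a > 0`, `limsup_{γ→0⁺} λ_{1,γ,a} ≤ 3 + (3/2) b₀ a`; in particular,
for `a > -2/b₀` the principal eigenvalue is negative for all small `γ > 0`. -/
theorem limsup_lam1_le (Icut : ℝ → ℝ) (hsmooth : ContDiff ℝ (⊤ : ℕ∞) Icut)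
    (heven : ∀ x, Icut (-x) = Icut x) (hnonneg : ∀ x, 0 ≤ Icut x)
    (hone : ∀ x ∈ Set.Icc (-1:ℝ) 1, Icut x = 1)
    (hzero : ∀ x : ℝ, 2 ≤ |x| → Icut x = 0)
    (hmono : AntitoneOn Icut (Set.Icc 1 2))
    (β a : ℝ) (hβ : β ≠ 0) (ha : 0 < a) :
    Filter.limsup (fun γ => lam1 Icut β γ a) (nhdsWithin 0 (Set.Ioi 0)) ≤
        3 + 3 / 2 * b0 Icut * a ∧
      (a > -2 / b0 Icut →
        ∀ᶠ γ in nhdsWithin 0 (Set.Ioi 0), lam1 Icut β γ a < 0) := by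
  obtain ⟨⟨C, hC⟩, hlt⟩ := exists_lam1_bounds hsmooth heven hone hzero β a
  have hb0 : b0 Icut < 0 := b0_neg hsmooth.continuous hnonneg (hone 1 (by norm_num))
  refine ⟨le_of_forall_pos_le_add fun ε hε => ?_, fun h => hlt 0 ?_⟩
  · have hbdd : IsBoundedUnder (· ≥ ·) (nhdsWithin 0 (Ioi 0)) fun γ => lam1 Icut β γ a := ⟨C, hC⟩
    exact limsup_le_of_le hbdd.isCoboundedUnder_le
      ((hlt _ (by linarith)).mono fun γ hγ => hγ.le)
  · rw [gt_iff_lt, div_lt_iff_of_neg hb0] at h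
    linarith
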